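/- Let n ∈ ℕ, t ∈ [0, 1/2), and set x = x(t) = (1/2)(1-2t + 1/(1-2t)). Then the second derivative of F_n satisfies F_n''(t) = 4 (x - √(x²-1))^{n-2} [2n² P_n(x) - (x + (2n-1)√(x²-1)) P_n'(x)], where F_n(t) = Σ_{k=0}^{n} (C(n,k) t^k (1-t)^{n-k})² and P_n is the n-th Legendre polynomial. -/

import Mathlib

/-- The sum of the squared Bernstein basis polynomials:
`F_n(t) = ∑_{k=0}^{n} (C(n,k) t^k (1-t)^{n-k})²`. -/
noncomputable def bernsteinSqSum (n : ℕ) (t : ℝ) : ℝ :=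
  ∑ k ∈ Finset.range (n + 1), ((n.choose k : ℝ) * t ^ k * (1 - t) ^ (n - k)) ^ 2

/-- The `n`-th Legendre polynomial, via Rodrigues' formula
`P_n(x) = (1/(2^n n!)) dⁿ/dxⁿ (x²-1)ⁿ`. -/
noncomputable def legendreP (n : ℕ) : ℝ → ℝ := fun x =>
  (1 / (2 ^ n * (n.factorial : ℝ))) * iteratedDeriv n (fun y => (y ^ 2 - 1) ^ n) x

open Polynomial in
/-- The `n`-th Legendre polynomial as an element of `ℝ[X]`, via Rodrigues' formula. -/
noncomputable def legendrePoly (n : ℕ) : ℝ[X] :=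
  C (1 / (2 ^ n * (n.factorial : ℝ))) * derivative^[n] ((X ^ 2 - 1) ^ n)

open Polynomial in
theorem Polynomial.iteratedDeriv_eval (p : ℝ[X]) (n : ℕ) :
    iteratedDeriv n (fun y => p.eval y) = fun y => (derivative^[n] p).eval y := by
  induction n with
  | zero => simp
  | succ n ih =>
    rw [iteratedDeriv_succ, ih, Function.iterate_succ_apply']
    ext y
    exact Polynomial.deriv _

theorem legendreP_eq_eval (n : ℕ) : legendreP n = fun x => (legendrePoly n).eval x := by
  have h : (fun y : ℝ => (y ^ 2 - 1) ^ n) =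
      fun y => Polynomial.eval y ((Polynomial.X ^ 2 - 1) ^ n) := by
    ext y; simp
  ext x
  simp [legendreP, legendrePoly, h, Polynomial.iteratedDeriv_eval]

open Polynomial in
theorem iterate_derivative_X_sq_sub_one_pow_recurrence (n m : ℕ) :
    (X ^ 2 - 1) * derivative^[m + 2] ((X ^ 2 - 1 : ℝ[X]) ^ n) +
        2 * ((m : ℝ[X]) + 1) * X * derivative^[m + 1] ((X ^ 2 - 1 : ℝ[X]) ^ n) +
        (m : ℝ[X]) * ((m : ℝ[X]) + 1) * derivative^[m] ((X ^ 2 - 1 : ℝ[X]) ^ n) =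
      2 * (n : ℝ[X]) * (X * derivative^[m + 1] ((X ^ 2 - 1 : ℝ[X]) ^ n) +
        ((m : ℝ[X]) + 1) * derivative^[m] ((X ^ 2 - 1 : ℝ[X]) ^ n)) := by
  induction m with
  | zero =>
    have h : (X ^ 2 - 1) * derivative ((X ^ 2 - 1 : ℝ[X]) ^ n) =
        2 * (n : ℝ[X]) * (X * (X ^ 2 - 1) ^ n) := by
      cases n with
      | zero => simp
      | succ n =>
        simp [derivative_pow, C_ofNat]
        ring
    have h' := congrArg derivative h
    simp only [derivative_mul, derivative_sub, derivative_X_sq, derivative_one, derivative_natCast,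
      derivative_ofNat, derivative_X, C_ofNat] at h'
    simp only [Function.iterate_succ_apply', Function.iterate_zero, id_eq, Nat.cast_zero]
    linear_combination h'
  | succ m ih =>
    have h' := congrArg derivative ih
    simp only [derivative_mul, derivative_add, derivative_sub, derivative_X_sq, derivative_one,
      derivative_natCast, derivative_ofNat, derivative_X, C_ofNat,
      ← Function.iterate_succ_apply' derivative] at h'
    push_cast
    linear_combination h'

open Polynomial in
/-- The differential equation of the Legendre polynomials. -/
theorem legendrePoly_ode (n : ℕ) :
    (X ^ 2 - 1) * derivative (derivative (legendrePoly n)) +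
      2 * X * derivative (legendrePoly n) = (n : ℝ[X]) * ((n : ℝ[X]) + 1) * legendrePoly n := by
  have h := iterate_derivative_X_sq_sub_one_pow_recurrence n n
  simp only [legendrePoly, derivative_C_mul, ← Function.iterate_succ_apply' derivative]
  linear_combination C (1 / (2 ^ n * (n.factorial : ℝ))) * h

open Polynomial in
theorem eval_legendrePoly (n : ℕ) (x : ℝ) :
    (legendrePoly n).eval x =
      ∑ k ∈ Finset.range (n + 1),
        (n.choose k : ℝ) ^ 2 * ((x - 1) / 2) ^ k * ((x + 1) / 2) ^ (n - k) := by
  have h : (X ^ 2 - 1 : ℝ[X]) ^ n = (X - C 1) ^ n * (X + C 1) ^ n := by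
    rw [← mul_pow, C_1]; ring
  rw [legendrePoly, h, iterate_derivative_mul, eval_mul, eval_finsetSum, eval_C, Finset.mul_sum]
  refine Finset.sum_congr rfl fun k hk => ?_
  have hk : k ≤ n := Nat.lt_succ_iff.mp (Finset.mem_range.mp hk)
  have hf : (n.descFactorial (n - k) * n.descFactorial k : ℝ) = n.factorial * n.choose k := by
    rw [Nat.descFactorial_eq_factorial_mul_choose, Nat.descFactorial_eq_factorial_mul_choose,
      Nat.choose_symm hk, ← Nat.choose_mul_factorial_mul_factorial hk]
    push_cast
    ring
  have h2 : (2 : ℝ) ^ n = 2 ^ k * 2 ^ (n - k) := by rw [← pow_add, Nat.add_sub_cancel' hk]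
  have hn : (n.factorial : ℝ) ≠ 0 := by positivity
  rw [iterate_derivative_X_sub_pow, iterate_derivative_X_add_pow, Nat.sub_sub_self hk]
  simp only [nsmul_eq_mul, eval_mul, eval_natCast, eval_pow, eval_sub, eval_add, eval_X, eval_C,
    div_pow]
  rw [h2]
  field_simp
  linear_combination (n.choose k : ℝ) * (x - 1) ^ k * (x + 1) ^ (n - k) * hf

theorem bernsteinSqSum_eq_legendrePoly (n : ℕ) {t : ℝ} (ht : 1 - 2 * t ≠ 0) :
    bernsteinSqSum n t = (1 - 2 * t) ^ n *
      (legendrePoly n).eval ((1 / 2) * (1 - 2 * t + 1 / (1 - 2 * t))) := by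
  rw [eval_legendrePoly, bernsteinSqSum, Finset.mul_sum]
  refine Finset.sum_congr rfl fun k hk => ?_
  have hk : k ≤ n := Nat.lt_succ_iff.mp (Finset.mem_range.mp hk)
  have hs : (1 - 2 * t) ^ k * (1 - 2 * t) ^ (n - k) ≠ 0 := by positivity
  have h₁ : ((1 / 2) * (1 - 2 * t + 1 / (1 - 2 * t)) - 1) / 2 = t ^ 2 / (1 - 2 * t) := by
    field_simp; ring
  have h₂ : ((1 / 2) * (1 - 2 * t + 1 / (1 - 2 * t)) + 1) / 2 = (1 - t) ^ 2 / (1 - 2 * t) := by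
    field_simp; ring
  have h₃ : (1 - 2 * t) ^ n = (1 - 2 * t) ^ k * (1 - 2 * t) ^ (n - k) := by
    rw [← pow_add, Nat.add_sub_cancel' hk]
  rw [h₁, h₂, h₃, div_pow, div_pow, ← pow_mul, ← pow_mul, mul_comm 2 k, mul_comm 2 (n - k),
    pow_mul, pow_mul]
  generalize 1 - 2 * t = s at *
  field_simp

theorem hasDerivAt_one_sub_two_mul_pow_mul (n : ℕ) {t g' : ℝ} {g : ℝ → ℝ} (ht : 1 - 2 * t ≠ 0)
    (hg : HasDerivAt g g' t) :
    HasDerivAt (fun τ => (1 - 2 * τ) ^ n * g τ)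
      ((1 - 2 * t) ^ n * (g' - 2 * n * g t / (1 - 2 * t))) t := by
  have hs : HasDerivAt (fun τ : ℝ => 1 - 2 * τ) (-2) t := by
    simpa using ((hasDerivAt_id t).const_mul 2).const_sub 1
  refine ((hs.fun_pow n).fun_mul hg).congr_deriv ?_
  cases n with
  | zero => simp
  | succ n =>
    simp only [Nat.add_sub_cancel]
    field_simp
    ring

theorem hasDerivAt_one_sub_two_mul_inv {t : ℝ} (ht : 1 - 2 * t ≠ 0) :
    HasDerivAt (fun τ : ℝ => (1 - 2 * τ)⁻¹) (2 / (1 - 2 * t) ^ 2) t := by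
  have hs : HasDerivAt (fun τ : ℝ => 1 - 2 * τ) (-2) t := by
    simpa using ((hasDerivAt_id t).const_mul 2).const_sub 1
  simpa using hs.fun_inv ht

theorem hasDerivAt_half_mul_add_inv {t : ℝ} (ht : 1 - 2 * t ≠ 0) :
    HasDerivAt (fun τ : ℝ => (1 / 2) * (1 - 2 * τ + 1 / (1 - 2 * τ)))
      (-1 + ((1 - 2 * t)⁻¹) ^ 2) t := by
  have hs : HasDerivAt (fun τ : ℝ => 1 - 2 * τ) (-2) t := by
    simpa using ((hasDerivAt_id t).const_mul 2).const_sub 1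
  simp only [one_div (1 - 2 * _ : ℝ)]
  refine ((hs.fun_add (hasDerivAt_one_sub_two_mul_inv ht)).const_mul (1 / 2)).congr_deriv ?_
  field_simp

theorem hasDerivAt_bernsteinSqSum (n : ℕ) {t : ℝ} (ht : 1 - 2 * t ≠ 0) :
    HasDerivAt (bernsteinSqSum n)
      ((1 - 2 * t) ^ n *
        ((legendrePoly n).derivative.eval ((1 / 2) * (1 - 2 * t + 1 / (1 - 2 * t))) *
            (-1 + ((1 - 2 * t)⁻¹) ^ 2) -
          2 * n * (legendrePoly n).eval ((1 / 2) * (1 - 2 * t + 1 / (1 - 2 * t))) /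
            (1 - 2 * t))) t := by
  have hcont : Continuous fun τ : ℝ => 1 - 2 * τ := by fun_prop
  refine (hasDerivAt_one_sub_two_mul_pow_mul n ht
    (((legendrePoly n).hasDerivAt _).comp t (hasDerivAt_half_mul_add_inv ht))).congr_of_eventuallyEq
    ?_
  filter_upwards [hcont.continuousAt.eventually_ne ht] with τ hτ
  exact bernsteinSqSum_eq_legendrePoly n hτ

theorem deriv2_bernsteinSqSum_eq (n : ℕ) (t x : ℝ) (ht : t ∈ Set.Ico (0 : ℝ) (1 / 2))
    (hx : x = (1 / 2) * (1 - 2 * t + 1 / (1 - 2 * t))) :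
    deriv (deriv (bernsteinSqSum n)) t =
      4 * (x - Real.sqrt (x ^ 2 - 1)) ^ ((n : ℝ) - 2) *
        (2 * (n : ℝ) ^ 2 * legendreP n x -
          (x + (2 * (n : ℝ) - 1) * Real.sqrt (x ^ 2 - 1)) * deriv (legendreP n) x) := by
  have hpos : 0 < 1 - 2 * t := by linarith [ht.2]
  have hne := hpos.ne'
  have hsqrt : Real.sqrt (x ^ 2 - 1) = (1 / (1 - 2 * t) - (1 - 2 * t)) / 2 := by
    have h : x ^ 2 - 1 = ((1 / (1 - 2 * t) - (1 - 2 * t)) / 2) ^ 2 := by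
      rw [hx]; field_simp; ring
    have h₁ : 1 ≤ 1 / (1 - 2 * t) := by
      rw [le_div_iff₀ hpos]; linarith [ht.1]
    rw [h, Real.sqrt_sq]
    linarith [ht.1]
  have hsub : x - Real.sqrt (x ^ 2 - 1) = 1 - 2 * t := by rw [hsqrt, hx]; ring
  have hcont : Continuous fun τ : ℝ => 1 - 2 * τ := by fun_prop
  have hderiv : deriv (bernsteinSqSum n) =ᶠ[nhds t] fun τ => (1 - 2 * τ) ^ n *
        ((legendrePoly n).derivative.eval ((1 / 2) * (1 - 2 * τ + 1 / (1 - 2 * τ))) *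
            (-1 + ((1 - 2 * τ)⁻¹) ^ 2) -
          2 * n * (legendrePoly n).eval ((1 / 2) * (1 - 2 * τ + 1 / (1 - 2 * τ))) *
            (1 - 2 * τ)⁻¹) := by
    filter_upwards [hcont.continuousAt.eventually_ne hne] with τ hτ
    rw [(hasDerivAt_bernsteinSqSum n hτ).deriv]
    simp only [div_eq_mul_inv]
  have hX := hasDerivAt_half_mul_add_inv hne
  have hI := hasDerivAt_one_sub_two_mul_inv hne
  have hp := ((legendrePoly n).hasDerivAt _).comp t hX
  have hp' := ((legendrePoly n).derivative.hasDerivAt _).comp t hX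
  have hD := hasDerivAt_one_sub_two_mul_pow_mul n hne
    ((hp'.mul ((hI.pow 2).const_add (-1))).sub ((hp.const_mul (2 * (n : ℝ))).mul hI))
  have hode := congrArg (Polynomial.eval x) (legendrePoly_ode n)
  simp only [Polynomial.eval_add, Polynomial.eval_sub, Polynomial.eval_mul, Polynomial.eval_pow,
    Polynomial.eval_X, Polynomial.eval_one, Polynomial.eval_natCast, Polynomial.eval_ofNat] at hode
  have hrpow : (1 - 2 * t) ^ ((n : ℝ) - 2) = (1 - 2 * t) ^ n / (1 - 2 * t) ^ 2 := by
    rw [Real.rpow_sub hpos, Real.rpow_natCast, ← Real.rpow_natCast _ 2, Nat.cast_ofNat]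
  rw [hderiv.deriv_eq]
  refine hD.deriv.trans ?_
  rw [hsub, hrpow, hsqrt, legendreP_eq_eval, Polynomial.deriv]
  simp only [Function.comp_apply, Pi.mul_apply, Pi.sub_apply, Pi.pow_apply, ← hx]
  generalize (legendrePoly n).eval x = p at *
  generalize (legendrePoly n).derivative.eval x = p' at *
  generalize (legendrePoly n).derivative.derivative.eval x = p'' at *
  clear hD hp hp' hX hI hderiv hsub hsqrt hrpow
  subst hx
  generalize 1 - 2 * t = s at *
  norm_num only [pow_one, Nat.cast_ofNat]
  field_simp at hode ⊢
  linear_combination 2 * hode
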